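/- There do not exist real numbers a, b, f, g with 0 < a < f < g < b such that both a + b < f + g and 1/a + 1/b < 1/f + 1/g hold. -/

import Mathlib

/-- There are no positive reals `a < f < g < b` with both `a + b < f + g` and
`1/a + 1/b < 1/f + 1/g`. -/
theorem no_interlaced_double_inequality :
    ¬ ∃ a b f g : ℝ, 0 < a ∧ a < f ∧ f < g ∧ g < b ∧
      a + b < f + g ∧ 1 / a + 1 / b < 1 / f + 1 / g := by
  rintro ⟨a, b, f, g, ha, haf, hfg, hgb, hsum, hinv⟩
  have hf : 0 < f := ha.trans haf
  have hg : 0 < g := hf.trans hfg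
  have hb : 0 < b := hg.trans hgb
  have hprod : a * f ≤ g * b := by gcongr <;> linarith
  have hdiff : (b - g) / (g * b) ≤ (f - a) / (a * f) :=
    div_le_div₀ (by linarith) (by linarith) (by positivity) hprod
  have hleft : 1 / a - 1 / f = (f - a) / (a * f) := by field_simp
  have hright : 1 / g - 1 / b = (b - g) / (g * b) := by field_simp
  linarith
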